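/- Example 2 verification: Let M' be the causal model with one exogenous binary variable C, endogenous binary variable A with equation A = C, and endogenous variable E with range {0,1,2} and equation E = A + C. Then there is no directed path p in M' such that (1_C,0_C) ⤳_p (2_E,0_E), but (1_C,0_C) are potential joint ancestors of (2_E,0_E) in M', via (1_C,0_C) ⤳ (1_C,1_A; 0_C,0_A) ⤳ (2_E,0_E) (note that the intermediate set {C,A} overlaps with {C}). -/

import Mathlib

set_option linter.unusedVariables false

attribute [local instance] Classical.propDecidable

/-- A causal model `M = ((U,V,R),F)` with exogenous variables `U`, endogenous
variables `V`, ranges `RU u` / `RV v`, and for each endogenous variable a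
structural equation giving its value in terms of the values of all the other
variables (the equation may not depend on the variable's own value). -/
structure CausalModel (U V : Type) (RU : U → Type) (RV : V → Type) where
  F : ∀ X : V, (∀ u, RU u) → (∀ v, RV v) → RV X
  selfIndep : ∀ (X : V) (ctx : ∀ u, RU u) (a a' : ∀ v, RV v),
    (∀ Y : V, Y ≠ X → a Y = a' Y) → F X ctx a = F X ctx a'

namespace CausalModel

variable {U V : Type} {RU : U → Type} {RV : V → Type}

/-- `Y` depends on the endogenous variable `X`: for some context and some setting
of the endogenous variables, varying the value of `X` changes the value of `F Y`.
(`X` is then an (endogenous) parent of `Y`.) -/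
def DependsOnE (M : CausalModel U V RU RV) (Y X : V) : Prop :=
  X ≠ Y ∧ ∃ (ctx : ∀ u, RU u) (a : ∀ v, RV v) (x x' : RV X),
    M.F Y ctx (Function.update a X x) ≠ M.F Y ctx (Function.update a X x')

/-- `Y` depends on the exogenous variable `X`. -/
def DependsOnX (M : CausalModel U V RU RV) (Y : V) (X : U) : Prop :=
  ∃ (ctx : ∀ u, RU u) (a : ∀ v, RV v) (x x' : RU X),
    M.F Y (Function.update ctx X x) a ≠ M.F Y (Function.update ctx X x') a

/-- `M` is strongly recursive: there is a (strict) partial order on the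
endogenous variables such that whenever `Y` depends on `X`, `X` strictly
precedes `Y`. -/
def StronglyRecursive (M : CausalModel U V RU RV) : Prop :=
  ∃ lt : V → V → Prop, IsStrictOrder V lt ∧ ∀ Y X : V, M.DependsOnE Y X → lt X Y

/-- `a` simultaneously satisfies all structural equations of `M` in context `ctx`. -/
def Solves (M : CausalModel U V RU RV) (ctx : ∀ u, RU u) (a : ∀ v, RV v) : Prop :=
  ∀ X : V, a X = M.F X ctx a

/-- `(M,ctx) ⊨ P`: `P` holds of the solution of the equations of `M` in context `ctx`. -/
def Sat (M : CausalModel U V RU RV) (ctx : ∀ u, RU u) (P : (∀ v, RV v) → Prop) : Prop :=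
  ∀ a, M.Solves ctx a → P a

/-- The intervened model `M_{S ← b}`: the equation of each variable in `S` is
replaced by the constant value given by `b`; other equations are unchanged. -/
noncomputable def intervene (M : CausalModel U V RU RV) (S : Set V) (b : ∀ v, RV v) :
    CausalModel U V RU RV where
  F X ctx a := if X ∈ S then b X else M.F X ctx a
  selfIndep := by
    intro X ctx a a' h
    by_cases hX : X ∈ S
    · simp [hX]
    · simpa [hX] using M.selfIndep X ctx a a' h

/-- `X` is a parent of `Y` (both endogenous). -/
def ParentE (M : CausalModel U V RU RV) (X Y : V) : Prop := M.DependsOnE Y X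

/-- `X` is an ancestor of `Y` (both endogenous): transitive closure of parenthood. -/
def AncestorE (M : CausalModel U V RU RV) : V → V → Prop :=
  Relation.TransGen fun X Y => M.DependsOnE Y X

/-- The exogenous variable `X` is an ancestor of the endogenous variable `Y`. -/
def AncestorX (M : CausalModel U V RU RV) (X : U) (Y : V) : Prop :=
  ∃ Z : V, M.DependsOnX Z X ∧ (Z = Y ∨ M.AncestorE Z Y)

/-- `(x,x') ⤳ (y,y')` with witness `(ctx, z)`:
`F_Y(x,z,ctx) = y` and `F_Y(x',z,ctx) = y'`. -/
def LeadsToWith (M : CausalModel U V RU RV) (X : V) (x x' : RV X) (Y : V) (y y' : RV Y)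
    (ctx : ∀ u, RU u) (z : ∀ v, RV v) : Prop :=
  M.F Y ctx (Function.update z X x) = y ∧ M.F Y ctx (Function.update z X x') = y'

/-- `x` rather than `x'` is a potential parent of `y` rather than `y'`
(single endogenous variables). -/
def PotParentEE (M : CausalModel U V RU RV) (X : V) (x x' : RV X) (Y : V) (y y' : RV Y) :
    Prop :=
  X ≠ Y ∧ x ≠ x' ∧ y ≠ y' ∧ ∃ ctx z, M.LeadsToWith X x x' Y y y' ctx z

/-- `x` rather than `x'` (values of an exogenous variable `X`) is a potential
parent of `y` rather than `y'`. -/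
def PotParentXE (M : CausalModel U V RU RV) (X : U) (x x' : RU X) (Y : V) (y y' : RV Y) :
    Prop :=
  x ≠ x' ∧ y ≠ y' ∧ ∃ (ctx : ∀ u, RU u) (z : ∀ v, RV v),
    M.F Y (Function.update ctx X x) z = y ∧ M.F Y (Function.update ctx X x') z = y'

/-- `(x,x') ⤳_p (y,y')` for some directed path `p` starting at the exogenous
variable `X`: a chain of single-variable potential-parenthood steps. -/
inductive PotAncX (M : CausalModel U V RU RV) (X : U) (x x' : RU X) :
    ∀ Y : V, RV Y → RV Y → Prop
  | base {Y : V} {y y' : RV Y} : M.PotParentXE X x x' Y y y' → PotAncX M X x x' Y y y'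
  | step {Z : V} {z z' : RV Z} {Y : V} {y y' : RV Y} :
      PotAncX M X x x' Z z z' → M.PotParentEE Z z z' Y y y' → PotAncX M X x x' Y y y'

/-- `(x,x') ⤳_p (y,y')` for some directed path `p` between endogenous variables. -/
inductive PotAncE (M : CausalModel U V RU RV) (X : V) (x x' : RV X) :
    ∀ Y : V, RV Y → RV Y → Prop
  | base {Y : V} {y y' : RV Y} : M.PotParentEE X x x' Y y y' → PotAncE M X x x' Y y y'
  | step {Z : V} {z z' : RV Z} {Y : V} {y y' : RV Y} :
      PotAncE M X x x' Z z z' → M.PotParentEE Z z z' Y y y' → PotAncE M X x x' Y y y'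

/-- Direct sufficiency, Def. 3 (with possibly mixed exogenous/endogenous source
`(Se,xe) ∪ (Sv,xv)` and target `(Te,ye) ∪ (Tv,yv)`; in the basic case
`Se = Te = ∅`).  For every context agreeing with the exogenous part of the
source and every setting `z` of the endogenous variables outside the source and
the target, the target values are guaranteed. -/
def DirectlySufficient (M : CausalModel U V RU RV)
    (Se : Set U) (xe : ∀ u, RU u) (Sv : Set V) (xv : ∀ v, RV v)
    (Te : Set U) (ye : ∀ u, RU u) (Tv : Set V) (yv : ∀ v, RV v) : Prop :=
  ∀ ctx : ∀ u, RU u, (∀ u ∈ Se, ctx u = xe u) →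
    (∀ u ∈ Te, ctx u = ye u) ∧
    ∀ z : ∀ v, RV v,
      (M.intervene (Sv ∪ (Sv ∪ Tv)ᶜ) (Sv.piecewise xv z)).Sat ctx
        fun a => ∀ v ∈ Tv, a v = yv v

/-- `(xv on Sv)` is weakly sufficient for `(yv on Tv)` w.r.t. `(M, ctx)`:
`(M,ctx) ⊨ [Sv ← xv] Tv = yv`. -/
def WeaklySufficient (M : CausalModel U V RU RV) (ctx : ∀ u, RU u)
    (Sv : Set V) (xv : ∀ v, RV v) (Tv : Set V) (yv : ∀ v, RV v) : Prop :=
  (M.intervene Sv xv).Sat ctx fun a => ∀ v ∈ Tv, a v = yv v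

/-- Sufficiency, Def. 8: the chaining (transitive closure) of direct sufficiency,
starting from a source that may contain exogenous values `(Se,xe)`. -/
inductive Sufficient (M : CausalModel U V RU RV)
    (Se : Set U) (xe : ∀ u, RU u) (Sv : Set V) (xv : ∀ v, RV v) :
    Set V → (∀ v, RV v) → Prop
  | base (Tv : Set V) (yv : ∀ v, RV v) :
      M.DirectlySufficient Se xe Sv xv ∅ xe Tv yv → Sufficient M Se xe Sv xv Tv yv
  | step (Tv : Set V) (yv : ∀ v, RV v) (Tv' : Set V) (yv' : ∀ v, RV v) :
      Sufficient M Se xe Sv xv Tv yv →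
      M.DirectlySufficient ∅ xe Tv yv ∅ xe Tv' yv' →
      Sufficient M Se xe Sv xv Tv' yv'

/-- `(x⃗,x⃗') ⤳ (y⃗,y⃗')` via the explicit witness `(Ze,ze) ∪ (Zv,zv)`:
the source and target are distinct sets of variables, the contrast values
differ on the respective domains, `(z⃗,x⃗)` is directly sufficient for `y⃗`,
`(z⃗,x⃗')` is directly sufficient for `y⃗'`, and the source is minimal. -/
def JointParentVia (M : CausalModel U V RU RV)
    (Se : Set U) (xe xe' : ∀ u, RU u) (Sv : Set V) (xv xv' : ∀ v, RV v)
    (Te : Set U) (ye ye' : ∀ u, RU u) (Tv : Set V) (yv yv' : ∀ v, RV v)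
    (Ze : Set U) (ze : ∀ u, RU u) (Zv : Set V) (zv : ∀ v, RV v) : Prop :=
  (¬(Se = Te ∧ Sv = Tv)) ∧
  (∀ u ∈ Se, xe u ≠ xe' u) ∧ (∀ v ∈ Sv, xv v ≠ xv' v) ∧
  (∀ u ∈ Te, ye u ≠ ye' u) ∧ (∀ v ∈ Tv, yv v ≠ yv' v) ∧
  Disjoint Ze Se ∧ Disjoint Zv Sv ∧
  M.DirectlySufficient (Ze ∪ Se) (Se.piecewise xe ze) (Zv ∪ Sv) (Sv.piecewise xv zv)
    Te ye Tv yv ∧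
  M.DirectlySufficient (Ze ∪ Se) (Se.piecewise xe' ze) (Zv ∪ Sv) (Sv.piecewise xv' zv)
    Te ye' Tv yv' ∧
  ∀ (Se' : Set U) (Sv' : Set V), Se' ⊆ Se → Sv' ⊆ Sv → ¬(Se' = Se ∧ Sv' = Sv) →
    ¬(M.DirectlySufficient (Ze ∪ Se') (Se'.piecewise xe ze) (Zv ∪ Sv')
        (Sv'.piecewise xv zv) Te ye Tv yv ∧
      M.DirectlySufficient (Ze ∪ Se') (Se'.piecewise xe' ze) (Zv ∪ Sv')
        (Sv'.piecewise xv' zv) Te ye' Tv yv')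

/-- Potential joint parenthood, Def. 4: `(x⃗,x⃗') ⤳ (y⃗,y⃗')` for some witness. -/
def PotJointParent (M : CausalModel U V RU RV)
    (Se : Set U) (xe xe' : ∀ u, RU u) (Sv : Set V) (xv xv' : ∀ v, RV v)
    (Te : Set U) (ye ye' : ∀ u, RU u) (Tv : Set V) (yv yv' : ∀ v, RV v) : Prop :=
  ∃ (Ze : Set U) (ze : ∀ u, RU u) (Zv : Set V) (zv : ∀ v, RV v),
    M.JointParentVia Se xe xe' Sv xv xv' Te ye ye' Tv yv yv' Ze ze Zv zv

/-- Actual joint parenthood w.r.t. `(M,u)`: potential joint parenthood by a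
witness whose exogenous part is contained in `u` and whose endogenous part
(as well as the source) takes its actual value in `(M,u)`. -/
def ActJointParent (M : CausalModel U V RU RV) (u : ∀ u, RU u)
    (Se : Set U) (xe xe' : ∀ u, RU u) (Sv : Set V) (xv xv' : ∀ v, RV v)
    (Te : Set U) (ye ye' : ∀ u, RU u) (Tv : Set V) (yv yv' : ∀ v, RV v) : Prop :=
  ∃ (Ze : Set U) (ze : ∀ u, RU u) (Zv : Set V) (zv : ∀ v, RV v),
    M.JointParentVia Se xe xe' Sv xv xv' Te ye ye' Tv yv yv' Ze ze Zv zv ∧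
    (∀ w ∈ Ze, ze w = u w) ∧ (∀ w ∈ Se, xe w = u w) ∧
    M.Sat u fun a => (∀ v ∈ Zv, a v = zv v) ∧ (∀ v ∈ Sv, a v = xv v)

/-- Potential joint ancestry, Def. 5: `(x⃗,x⃗') ⤳_n (y⃗,y⃗')` for some network `n`,
i.e. the transitive closure of potential joint parenthood. -/
inductive PotJointAnc (M : CausalModel U V RU RV)
    (Se : Set U) (xe xe' : ∀ u, RU u) (Sv : Set V) (xv xv' : ∀ v, RV v) :
    ∀ (Te : Set U) (ye ye' : ∀ u, RU u) (Tv : Set V) (yv yv' : ∀ v, RV v), Prop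
  | base {Te : Set U} {ye ye' : ∀ u, RU u} {Tv : Set V} {yv yv' : ∀ v, RV v} :
      M.PotJointParent Se xe xe' Sv xv xv' Te ye ye' Tv yv yv' →
      PotJointAnc M Se xe xe' Sv xv xv' Te ye ye' Tv yv yv'
  | step {Te : Set U} {ye ye' : ∀ u, RU u} {Tv : Set V} {yv yv' : ∀ v, RV v}
      {Te' : Set U} {ye2 ye2' : ∀ u, RU u} {Tv' : Set V} {yv2 yv2' : ∀ v, RV v} :
      PotJointAnc M Se xe xe' Sv xv xv' Te ye ye' Tv yv yv' →
      M.PotJointParent Te ye ye' Tv yv yv' Te' ye2 ye2' Tv' yv2 yv2' →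
      PotJointAnc M Se xe xe' Sv xv xv' Te' ye2 ye2' Tv' yv2 yv2'

/-- Actual joint ancestry w.r.t. `(M,u)`, Def. 7. -/
inductive ActJointAnc (M : CausalModel U V RU RV) (u : ∀ u, RU u)
    (Se : Set U) (xe xe' : ∀ u, RU u) (Sv : Set V) (xv xv' : ∀ v, RV v) :
    ∀ (Te : Set U) (ye ye' : ∀ u, RU u) (Tv : Set V) (yv yv' : ∀ v, RV v), Prop
  | base {Te : Set U} {ye ye' : ∀ u, RU u} {Tv : Set V} {yv yv' : ∀ v, RV v} :
      M.ActJointParent u Se xe xe' Sv xv xv' Te ye ye' Tv yv yv' →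
      ActJointAnc M u Se xe xe' Sv xv xv' Te ye ye' Tv yv yv'
  | step {Te : Set U} {ye ye' : ∀ u, RU u} {Tv : Set V} {yv yv' : ∀ v, RV v}
      {Te' : Set U} {ye2 ye2' : ∀ u, RU u} {Tv' : Set V} {yv2 yv2' : ∀ v, RV v} :
      ActJointAnc M u Se xe xe' Sv xv xv' Te ye ye' Tv yv yv' →
      M.ActJointParent u Te ye ye' Tv yv yv' Te' ye2 ye2' Tv' yv2 yv2' →
      ActJointAnc M u Se xe xe' Sv xv xv' Te' ye2 ye2' Tv' yv2 yv2'

/-- Combine a family of values on `A` with a family of values on `B` into a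
family of values on `A ⊕ B`. -/
def extFn {A B : Type} {RA : A → Type} {RB : B → Type}
    (f : ∀ a, RA a) (g : ∀ b, RB b) : ∀ x : A ⊕ B, Sum.elim RA RB x
  | Sum.inl a => f a
  | Sum.inr b => g b

end CausalModel

open CausalModel

/-! STATEMENT 12 (Example 2): the model `M'` with one exogenous binary variable
`C` (represented by `Unit`), endogenous binary variable `A` with equation
`A = C`, and endogenous variable `E` with range `{0,1,2}` (`Fin 3`) and
equation `E = A + C`. -/

inductive EVar2 | A | E
deriving DecidableEq

/-- Ranges of the endogenous variables of Example 2. -/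
def RV2 : EVar2 → Type
  | .A => Bool
  | .E => Fin 3

/-- The model `M'` of Example 2: `A = C`, `E = A + C`. -/
def Ex2 : CausalModel Unit EVar2 (fun _ => Bool) RV2 where
  F X ctx a :=
    match X with
    | .A => ctx ()
    | .E => ((bif (a .A : Bool) then 1 else 0) + (bif ctx () then 1 else 0) : Fin 3)
  selfIndep := by
    intro X ctx a a' h
    cases X with
    | A => rfl
    | E =>
      have hA := h .A (by rintro ⟨⟩)
      show ((bif (a .A : Bool) then 1 else 0) + (bif ctx () then 1 else 0) : Fin 3)
         = ((bif (a' .A : Bool) then 1 else 0) + (bif ctx () then 1 else 0) : Fin 3)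
      rw [hA]

/-- Values `A = 1` (and a dummy value for `E`). -/
def w2T : ∀ v, RV2 v
  | .A => true
  | .E => (0 : Fin 3)

/-- Values `A = 0` (and a dummy value for `E`). -/
def w2F : ∀ v, RV2 v
  | .A => false
  | .E => (0 : Fin 3)

/-- Values with `E = 2` (dummy value for `A`). -/
def w2E2 : ∀ v, RV2 v
  | .A => false
  | .E => (2 : Fin 3)

/-- Values with `E = 0` (dummy value for `A`). -/
def w2E0 : ∀ v, RV2 v
  | .A => false
  | .E => (0 : Fin 3)

theorem CausalModel.PotAncX.potParentXE_or_exists_potParentEE {U V : Type} {RU : U → Type}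
    {RV : V → Type} {M : CausalModel U V RU RV} {X : U} {x x' : RU X} {Y : V} {y y' : RV Y}
    (h : M.PotAncX X x x' Y y y') :
    M.PotParentXE X x x' Y y y' ∨ ∃ (Z : V) (z z' : RV Z), M.PotParentEE Z z z' Y y y' := by
  cases h with
  | base h => exact Or.inl h
  | step _ h => exact Or.inr ⟨_, _, _, h⟩

theorem Ex2_F_E_eq_two_iff (ctx : Unit → Bool) (a : ∀ v, RV2 v) :
    Ex2.F EVar2.E ctx a = (2 : Fin 3) ↔ a EVar2.A = true ∧ ctx () = true := by
  change ((bif (a .A : Bool) then 1 else 0) + (bif ctx () then 1 else 0) : Fin 3) = 2 ↔ _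
  generalize ctx () = c
  generalize a EVar2.A = b
  revert b c
  change ∀ c b : Bool, ((bif b then 1 else 0) + (bif c then 1 else 0) : Fin 3) = 2 ↔
    b = true ∧ c = true
  decide

theorem Ex2_F_E_eq_zero_iff (ctx : Unit → Bool) (a : ∀ v, RV2 v) :
    Ex2.F EVar2.E ctx a = (0 : Fin 3) ↔ a EVar2.A = false ∧ ctx () = false := by
  change ((bif (a .A : Bool) then 1 else 0) + (bif ctx () then 1 else 0) : Fin 3) = 0 ↔ _
  generalize ctx () = c
  generalize a EVar2.A = b
  revert b c
  change ∀ c b : Bool, ((bif b then 1 else 0) + (bif c then 1 else 0) : Fin 3) = 0 ↔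
    b = false ∧ c = false
  decide

theorem not_potParentXE_Ex2_two_zero (x x' : Bool) :
    ¬ Ex2.PotParentXE () x x' EVar2.E (2 : Fin 3) (0 : Fin 3) := by
  rintro ⟨-, -, ctx, z, h, h'⟩
  have hA := ((Ex2_F_E_eq_two_iff _ _).1 h).1
  have hA' := ((Ex2_F_E_eq_zero_iff _ _).1 h').1
  exact Bool.noConfusion (hA.symm.trans hA')

theorem not_potParentEE_Ex2_two_zero (Z : EVar2) (z z' : RV2 Z) :
    ¬ Ex2.PotParentEE Z z z' EVar2.E (2 : Fin 3) (0 : Fin 3) := by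
  rintro ⟨-, -, -, ctx, w, h, h'⟩
  have hC := ((Ex2_F_E_eq_two_iff _ _).1 h).2
  have hC' := ((Ex2_F_E_eq_zero_iff _ _).1 h').2
  exact Bool.noConfusion (hC.symm.trans hC')

theorem not_potAncX_Ex2_two_zero (x x' : Bool) :
    ¬ Ex2.PotAncX () x x' EVar2.E (2 : Fin 3) (0 : Fin 3) := by
  intro h
  rcases h.potParentXE_or_exists_potParentEE with h | ⟨Z, z, z', h⟩
  · exact not_potParentXE_Ex2_two_zero _ _ h
  · exact not_potParentEE_Ex2_two_zero _ _ _ h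

/-- The value of `C` is directly sufficient for the same value of `C` and of `A`. -/
theorem Ex2_directlySufficient_C_A (xe : Unit → Bool) (xv yv : ∀ v, RV2 v)
    (hA : yv EVar2.A = xe ()) :
    Ex2.DirectlySufficient {()} xe ∅ xv {()} xe {EVar2.A} yv := by
  intro ctx hctx
  refine ⟨hctx, fun z a ha v hv => ?_⟩
  obtain rfl : v = EVar2.A := hv
  have h := ha EVar2.A
  simp only [intervene] at h
  rw [if_neg (by simp)] at h
  exact h.trans ((hctx () rfl).trans hA.symm)

/-- Joint values of `C` and `A` are directly sufficient for the resulting value of `E`. -/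
theorem Ex2_directlySufficient_CA_E (xe ye : Unit → Bool) (xv yv : ∀ v, RV2 v)
    (hE : yv EVar2.E = Ex2.F EVar2.E xe xv) :
    Ex2.DirectlySufficient {()} xe {EVar2.A} xv ∅ ye {EVar2.E} yv := by
  intro ctx hctx
  obtain rfl : ctx = xe := funext fun u => hctx u rfl
  refine ⟨fun u hu => hu.elim, fun z a ha v hv => ?_⟩
  obtain rfl : v = EVar2.E := hv
  have h := ha EVar2.E
  have h' := ha EVar2.A
  simp only [intervene] at h h'
  rw [if_neg (by simp)] at h
  rw [if_pos (by simp)] at h'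
  replace h' := h'.trans (if_pos rfl)
  rw [h, hE]
  refine Ex2.selfIndep _ _ _ _ fun Y hY => ?_
  cases Y with
  | A => exact h'
  | E => exact absurd rfl hY

/-- If `E = 2` is guaranteed, then the values of both `C` and `A` are fixed by the source. -/
theorem Ex2_source_of_directlySufficient_E_two (Se : Set Unit) (xe ye : Unit → Bool)
    (Sv : Set EVar2) (xv yv : ∀ v, RV2 v) (hSv : EVar2.E ∉ Sv) (hE : yv EVar2.E = (2 : Fin 3))
    (h : Ex2.DirectlySufficient Se xe Sv xv ∅ ye {EVar2.E} yv) :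
    () ∈ Se ∧ EVar2.A ∈ Sv := by
  let ctx : Unit → Bool := Se.piecewise xe fun _ => false
  let b : ∀ v, RV2 v := Sv.piecewise xv w2F
  let a : ∀ v, RV2 v := fun v => match v with
    | .A => b .A
    | .E => Ex2.F .E ctx b
  have hab : Ex2.F EVar2.E ctx b = Ex2.F EVar2.E ctx a :=
    Ex2.selfIndep _ _ _ _ fun Y hY => by
      cases Y with
      | A => rfl
      | E => exact absurd rfl hY
  have ha : (Ex2.intervene (Sv ∪ (Sv ∪ {EVar2.E})ᶜ) b).Solves ctx a := by
    intro X
    simp only [intervene]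
    cases X with
    | A =>
      rw [if_pos]
      by_cases hA : EVar2.A ∈ Sv <;> simp [hA]
    | E => rw [if_neg (by simp [hSv])]; exact hab
  have hctx : ∀ u ∈ Se, ctx u = xe u := fun u hu => Set.piecewise_eq_of_mem _ _ _ hu
  have h2 : Ex2.F EVar2.E ctx b = (2 : Fin 3) :=
    ((h ctx hctx).2 w2F a ha EVar2.E rfl).trans hE
  obtain ⟨hA, hC⟩ := (Ex2_F_E_eq_two_iff _ _).1 h2
  constructor
  · by_contra hn
    exact Bool.noConfusion (hC.symm.trans (Set.piecewise_eq_of_notMem _ _ _ hn))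
  · by_contra hn
    exact Bool.noConfusion (hA.symm.trans (Set.piecewise_eq_of_notMem _ _ _ hn))

theorem Ex2_potJointParent_C_CA :
    Ex2.PotJointParent {()} (fun _ => true) (fun _ => false) ∅ w2T w2T
      {()} (fun _ => true) (fun _ => false) {EVar2.A} w2T w2F := by
  refine ⟨∅, fun _ => false, ∅, w2F, ?_, by simp, by simp, by simp, ?_, by simp, by simp,
    ?_, ?_, ?_⟩
  · rintro ⟨-, h⟩
    exact Set.singleton_ne_empty _ h.symm
  · rintro v rfl h
    exact Bool.noConfusion h
  · rw [Set.empty_union, Set.empty_union]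
    convert Ex2_directlySufficient_C_A (fun _ => true) _ w2T rfl using 1
    exact funext fun u => if_pos rfl
  · rw [Set.empty_union, Set.empty_union]
    convert Ex2_directlySufficient_C_A (fun _ => false) _ w2F rfl using 1
    exact funext fun u => if_pos rfl
  · rintro Se' Sv' hSe hSv hne ⟨h, -⟩
    obtain rfl : Sv' = ∅ := Set.subset_empty_iff.1 hSv
    rcases Set.subset_singleton_iff_eq.1 hSe with rfl | rfl
    · have := (h (fun _ => false) (by simp)).1 () rfl
      exact Bool.noConfusion this
    · exact hne ⟨rfl, rfl⟩

theorem Ex2_potJointParent_CA_E :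
    Ex2.PotJointParent {()} (fun _ => true) (fun _ => false) {EVar2.A} w2T w2F
      ∅ (fun _ => true) (fun _ => true) {EVar2.E} w2E2 w2E0 := by
  refine ⟨∅, fun _ => false, ∅, w2F, ?_, by simp, ?_, by simp, ?_, by simp, by simp,
    ?_, ?_, ?_⟩
  · rintro ⟨h, -⟩
    exact Set.singleton_ne_empty _ h
  · rintro v rfl h
    exact Bool.noConfusion h
  · rintro v rfl
    change (2 : Fin 3) ≠ 0
    decide
  · rw [Set.empty_union, Set.empty_union]
    refine Ex2_directlySufficient_CA_E _ _ _ _ ((Ex2_F_E_eq_two_iff _ _).2 ⟨?_, ?_⟩).symm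
    · exact if_pos rfl
    · exact if_pos rfl
  · rw [Set.empty_union, Set.empty_union]
    refine Ex2_directlySufficient_CA_E _ _ _ _ ((Ex2_F_E_eq_zero_iff _ _).2 ⟨?_, ?_⟩).symm
    · exact if_pos rfl
    · exact if_pos rfl
  · rintro Se' Sv' hSe hSv hne ⟨h, -⟩
    rw [Set.empty_union, Set.empty_union] at h
    have hES : EVar2.E ∉ Sv' := fun hE => EVar2.noConfusion (hSv hE)
    obtain ⟨hC, hA⟩ := Ex2_source_of_directlySufficient_E_two _ _ _ _ _ _ hES rfl h
    exact hne ⟨hSe.antisymm (Set.singleton_subset_iff.2 hC),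
      hSv.antisymm (Set.singleton_subset_iff.2 hA)⟩

/-- Example 2 verification: there is no directed path `p` in
`M'` with `(1_C,0_C) ⤳_p (2_E,0_E)`, but `(1_C,0_C)` are potential joint
ancestors of `(2_E,0_E)` in `M'`, via
`(1_C,0_C) ⤳ (1_C,1_A; 0_C,0_A) ⤳ (2_E,0_E)`
(note that the intermediate set `{C,A}` overlaps with the source `{C}`). -/
theorem example2_verification :
    -- no single-variable path
    ¬ Ex2.PotAncX () true false EVar2.E (2 : Fin 3) (0 : Fin 3) ∧
    -- the two joint-parenthood steps of the network
    Ex2.PotJointParent {()} (fun _ => true) (fun _ => false) ∅ w2T w2T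
      {()} (fun _ => true) (fun _ => false) {EVar2.A} w2T w2F ∧
    Ex2.PotJointParent {()} (fun _ => true) (fun _ => false) {EVar2.A} w2T w2F
      ∅ (fun _ => true) (fun _ => true) {EVar2.E} w2E2 w2E0 ∧
    -- the resulting potential joint ancestry
    Ex2.PotJointAnc {()} (fun _ => true) (fun _ => false) ∅ w2T w2T
      ∅ (fun _ => true) (fun _ => true) {EVar2.E} w2E2 w2E0 := by
  exact ⟨not_potAncX_Ex2_two_zero _ _, Ex2_potJointParent_C_CA, Ex2_potJointParent_CA_E,
    .step (.base Ex2_potJointParent_C_CA) Ex2_potJointParent_CA_E⟩
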